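/- Assume n_4 ≥ n_2 (so n = n_4). Fix a Smith datum (U^{(4)}, V^{(4)}, d^{(4)}_1 | … | d^{(4)}_{s_4}) for the stacked matrix (E_{11}; E_{12}; E_{21}; E_{22}), and define H_4 = #{(u_1,…,u_{r_2}, v_1,…,v_{r_4}) ∈ (F_q^*)^{r_2+r_4} : Σ_{i=1}^{r_2} a_{1,i} u_i = b_1, Σ_{j=1}^{r_4} a_{2,j} v_j = b_2, and (u,v) satisfies the index condition for ((E_{11}; E_{12}; E_{21}; E_{22}), U^{(4)}, d^{(4)})}. Then the number of x ∈ F_q^n such that f_1(x) = 0, f_2(x) = 0, x^{E^{(1)}_i} ≠ 0 for all 1 ≤ i ≤ r_2, and x^{E^{(2)}_j} ≠ 0 for all 1 ≤ j ≤ r_4 equals H_4 · (q−1)^{n_4−s_4} · ∏_{j=1}^{s_4} gcd(q−1, d^{(4)}_j). -/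

import Mathlib

open Finset

/-- Stack the first `p1` rows of `E1` on top of the first `p2` rows of `E2`,
viewed as an integer matrix with `n` columns. -/
def stackM (E1 E2 : ℕ → ℕ → ℕ) (p1 p2 n : ℕ) :
    Matrix (Fin (p1 + p2)) (Fin n) ℤ :=
  Matrix.of fun i j =>
    if (i : ℕ) < p1 then (E1 (i : ℕ) (j : ℕ) : ℤ) else (E2 ((i : ℕ) - p1) (j : ℕ) : ℤ)

/-- `(U, V, d 0 ∣ d 1 ∣ ⋯ ∣ d (s-1))` is a Smith datum for the matrix `M`:
`U` and `V` are unimodular and `U * M * V` is diagonal with the positive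
invariant factors `d 0 ∣ ⋯ ∣ d (s-1)` on the diagonal and zeros elsewhere. -/
def IsSmithDatum {ρ n : ℕ} (M : Matrix (Fin ρ) (Fin n) ℤ)
    (U : Matrix (Fin ρ) (Fin ρ) ℤ) (V : Matrix (Fin n) (Fin n) ℤ)
    (s : ℕ) (d : ℕ → ℕ) : Prop :=
  IsUnit U.det ∧ IsUnit V.det ∧ s ≤ ρ ∧ s ≤ n ∧
    (∀ j, j < s → 0 < d j) ∧ (∀ j, j + 1 < s → d j ∣ d (j + 1)) ∧
    ∀ i k, (U * M * V) i k =
      if (i : ℕ) = (k : ℕ) ∧ (i : ℕ) < s then (d (i : ℕ) : ℤ) else 0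

/-- The index condition: writing `h' = U ⬝ w` (where `w` is the vector of
indices of the `uᵢ`), one has `gcd (m, d j) ∣ h'_j` for `j < s` and
`m ∣ h'_j` for `s ≤ j`. Here `m` plays the role of `q - 1`. -/
def IndexCond {ρ : ℕ} (m : ℕ) (U : Matrix (Fin ρ) (Fin ρ) ℤ)
    (s : ℕ) (d : ℕ → ℕ) (w : Fin ρ → ℤ) : Prop :=
  ∀ j : Fin ρ,
    (if (j : ℕ) < s then ((Nat.gcd m (d (j : ℕ))) : ℤ) else (m : ℤ)) ∣ (U.mulVec w) j

/-- The number of solutions of a linear congruence in one variable. -/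
theorem card_natCast_mul_eq_intCast (m d : ℕ) [NeZero m] (h : ℤ) :
    Nat.card {y : ZMod m // (d : ZMod m) * y = h} =
      if ((m.gcd d : ℕ) : ℤ) ∣ h then m.gcd d else 0 := by
  split_ifs with hd
  · obtain ⟨t, rfl⟩ := hd
    set y₀ : ZMod m := ((m.gcdB d * t : ℤ) : ZMod m) with hy₀
    have hsol : (d : ZMod m) * y₀ = (((m.gcd d : ℕ) : ℤ) * t : ℤ) := by
      rw [Nat.gcd_eq_gcd_ab, hy₀]
      push_cast
      simp
      ring
    have key := IsCyclic.card_powMonoidHom_ker (G := Multiplicative (ZMod m)) d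
    have hcard : Nat.card (Multiplicative (ZMod m)) = m :=
      (Nat.card_congr Multiplicative.toAdd).trans (Nat.card_zmod m)
    rw [hcard] at key
    refine Eq.trans (Nat.card_congr
      ((Equiv.subRight y₀).trans Multiplicative.ofAdd |>.subtypeEquiv ?_)) key
    intro y
    rw [MonoidHom.mem_ker, ← hsol, ← sub_eq_zero, ← mul_sub, ← nsmul_eq_mul]
    simp only [Equiv.trans_apply, Equiv.subRight_apply, powMonoidHom_apply, ← ofAdd_nsmul,
      ofAdd_eq_one]
  · have : IsEmpty {y : ZMod m // (d : ZMod m) * y = h} := by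
      refine ⟨fun ⟨y, hy⟩ => hd ?_⟩
      have h1 : ((h - d * (y.val : ℤ) : ℤ) : ZMod m) = 0 := by
        push_cast
        rw [← hy, ZMod.natCast_zmod_val, sub_self]
      rw [ZMod.intCast_zmod_eq_zero_iff_dvd] at h1
      have h2 : ((m.gcd d : ℕ) : ℤ) ∣ h - d * (y.val : ℤ) :=
        (Int.natCast_dvd_natCast.2 (Nat.gcd_dvd_left m d)).trans h1
      have h3 : ((m.gcd d : ℕ) : ℤ) ∣ d * (y.val : ℤ) :=
        (Int.natCast_dvd_natCast.2 (Nat.gcd_dvd_right m d)).mul_right _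
      simpa using dvd_add h2 h3
    exact Nat.card_of_isEmpty

/-- The number of solutions of a diagonal system of linear congruences. -/
theorem card_diagonal_mulVec_eq {ρ n : ℕ} (m : ℕ) [NeZero m] (D : Matrix (Fin ρ) (Fin n) ℤ)
    (s : ℕ) (d : ℕ → ℕ) (hsρ : s ≤ ρ) (hsn : s ≤ n)
    (hD : ∀ i k, D i k = if (i : ℕ) = (k : ℕ) ∧ (i : ℕ) < s then (d (i : ℕ) : ℤ) else 0)
    (h : Fin ρ → ℤ) [Decidable (∀ j : Fin ρ,
      (if (j : ℕ) < s then ((Nat.gcd m (d (j : ℕ))) : ℤ) else (m : ℤ)) ∣ h j)] :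
    Nat.card {y : Fin n → ZMod m //
        (D.map (Int.castRingHom (ZMod m))).mulVec y = fun i => (h i : ZMod m)} =
      if ∀ j : Fin ρ,
          (if (j : ℕ) < s then ((Nat.gcd m (d (j : ℕ))) : ℤ) else (m : ℤ)) ∣ h j
      then m ^ (n - s) * ∏ j ∈ range s, Nat.gcd m (d j) else 0 := by
  have hrow : ∀ (y : Fin n → ZMod m) (i : Fin ρ),
      (D.map (Int.castRingHom (ZMod m))).mulVec y i =
        if hi : (i : ℕ) < s then (d i : ZMod m) * y ⟨i, hi.trans_le hsn⟩ else 0 := by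
    intro y i
    simp only [Matrix.mulVec, dotProduct, Matrix.map_apply, hD]
    split_ifs with hi
    · rw [Finset.sum_eq_single ⟨i, hi.trans_le hsn⟩]
      · simp [hi]
      · intro k _ hk
        have : (i : ℕ) ≠ k := fun e => hk (Fin.ext e.symm)
        simp [this]
      · simp
    · exact Finset.sum_eq_zero fun k _ => by simp [hi]
  by_cases hlow : ∀ j : Fin ρ, s ≤ (j : ℕ) → (m : ℤ) ∣ h j
  · have hiff : ∀ y : Fin n → ZMod m,
        ((D.map (Int.castRingHom (ZMod m))).mulVec y = fun i => (h i : ZMod m)) ↔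
          ∀ k : Fin n, ∀ hk : (k : ℕ) < s,
            (d k : ZMod m) * y k = (h ⟨k, hk.trans_le hsρ⟩ : ZMod m) := by
      intro y
      rw [funext_iff]
      constructor
      · intro H k hk
        have := H ⟨k, hk.trans_le hsρ⟩
        rw [hrow] at this
        simpa [hk] using this
      · intro H i
        rw [hrow]
        split_ifs with hi
        · exact H ⟨i, hi.trans_le hsn⟩ hi
        · exact ((ZMod.intCast_zmod_eq_zero_iff_dvd _ _).2 (hlow i (not_lt.1 hi))).symm
    have e : {y : Fin n → ZMod m //
        (D.map (Int.castRingHom (ZMod m))).mulVec y = fun i => (h i : ZMod m)} ≃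
        ((k : Fin n) → {y : ZMod m // ∀ hk : (k : ℕ) < s,
          (d k : ZMod m) * y = (h ⟨k, hk.trans_le hsρ⟩ : ZMod m)}) :=
      (Equiv.subtypeEquivRight hiff).trans (Equiv.subtypePiEquivPi
        (p := fun (k : Fin n) (y : ZMod m) => ∀ hk : (k : ℕ) < s,
          (d k : ZMod m) * y = (h ⟨k, hk.trans_le hsρ⟩ : ZMod m)))
    rw [Nat.card_congr e, Nat.card_pi]
    let H : ℕ → ℤ := fun k => if hk : k < ρ then h ⟨k, hk⟩ else 0
    let g : ℕ → ℕ := fun k => if k < s then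
      (if ((m.gcd (d k) : ℕ) : ℤ) ∣ H k then m.gcd (d k) else 0) else m
    have hfac : ∀ k : Fin n, Nat.card {y : ZMod m // ∀ hk : (k : ℕ) < s,
          (d k : ZMod m) * y = (h ⟨k, hk.trans_le hsρ⟩ : ZMod m)} = g k := by
      intro k
      by_cases hk : (k : ℕ) < s
      · simp only [g, hk, if_true, forall_true_left, H, hk.trans_le hsρ, dif_pos]
        exact card_natCast_mul_eq_intCast m _ _
      · simp only [g, if_neg hk]
        exact (Nat.card_congr (Equiv.subtypeUnivEquiv fun y hk' => absurd hk' hk)).trans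
          (Nat.card_zmod m)
    simp only [hfac]
    rw [Fin.prod_univ_eq_prod_range g n, ← Finset.prod_range_mul_prod_Ico g hsn]
    have hIco : ∏ k ∈ Ico s n, g k = m ^ (n - s) := by
      rw [Finset.prod_congr rfl (g := fun _ => m), Finset.prod_const, Nat.card_Ico]
      intro k hk
      simp [g, not_lt.2 (Finset.mem_Ico.1 hk).1]
    rw [hIco, mul_comm]
    split_ifs with hall
    · congr 1
      refine Finset.prod_congr rfl fun k hk => ?_
      have hk' := Finset.mem_range.1 hk
      have := hall ⟨k, hk'.trans_le hsρ⟩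
      simp only [hk', if_true] at this
      simp [g, hk', H, hk'.trans_le hsρ, this]
    · push Not at hall
      obtain ⟨j, hj⟩ := hall
      have hjs : (j : ℕ) < s := by
        by_contra hc
        exact hj (by simpa [hc] using hlow j (not_lt.1 hc))
      simp only [hjs, if_true] at hj
      rw [Finset.prod_eq_zero (Finset.mem_range.2 hjs), mul_zero]
      simp [g, hjs, H, hj]
  · rw [if_neg]
    · have : IsEmpty {y : Fin n → ZMod m //
          (D.map (Int.castRingHom (ZMod m))).mulVec y = fun i => (h i : ZMod m)} := by
        refine ⟨fun ⟨y, hy⟩ => hlow fun j hj => ?_⟩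
        have := congrFun hy j
        rw [hrow, dif_neg (not_lt.2 hj)] at this
        exact (ZMod.intCast_zmod_eq_zero_iff_dvd _ _).1 this.symm
      exact Nat.card_of_isEmpty
    · intro H
      refine hlow fun j hj => ?_
      simpa [not_lt.2 hj] using H j

/-- The number of solutions of a system of linear congruences in terms of a Smith datum. -/
theorem IsSmithDatum.card_mulVec_eq {ρ n : ℕ} {M : Matrix (Fin ρ) (Fin n) ℤ}
    {U : Matrix (Fin ρ) (Fin ρ) ℤ} {V : Matrix (Fin n) (Fin n) ℤ} {s : ℕ} {d : ℕ → ℕ}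
    (hM : IsSmithDatum M U V s d) (m : ℕ) [NeZero m] (w : Fin ρ → ℤ)
    [Decidable (IndexCond m U s d w)] :
    Nat.card {x : Fin n → ZMod m //
        (M.map (Int.castRingHom (ZMod m))).mulVec x = fun i => (w i : ZMod m)} =
      if IndexCond m U s d w then m ^ (n - s) * ∏ j ∈ range s, Nat.gcd m (d j) else 0 := by
  obtain ⟨hU, hV, hsρ, hsn, -, -, hD⟩ := hM
  have key := card_diagonal_mulVec_eq m (U * M * V) s d hsρ hsn hD (U.mulVec w)
  let φ := Int.castRingHom (ZMod m)
  have hUφ : IsUnit (U.map φ) := ((Matrix.isUnit_iff_isUnit_det U).2 hU).map φ.mapMatrix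
  have hVφ : IsUnit (V.map φ) := ((Matrix.isUnit_iff_isUnit_det V).2 hV).map φ.mapMatrix
  refine (Nat.card_congr ((Equiv.ofBijective _ (Finite.injective_iff_bijective.1
    (Matrix.mulVec_injective_of_isUnit hVφ))).subtypeEquiv ?_)).symm.trans
      (key.trans (if_congr Iff.rfl rfl rfl))
  intro y
  have hUw : (fun i => ((U.mulVec w i : ℤ) : ZMod m)) =
      (U.map φ).mulVec (fun i => (w i : ZMod m)) := by
    funext i
    exact RingHom.map_mulVec φ U w i
  rw [hUw, Matrix.map_mul, Matrix.map_mul, ← Matrix.mulVec_mulVec, ← Matrix.mulVec_mulVec]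
  exact (Matrix.mulVec_injective_of_isUnit hUφ).eq_iff

/-- An index function for a generator `α` of `Fˣ` induces an isomorphism
`Fˣ ≃ ZMod (q - 1)`. -/
theorem exists_mulEquiv_zmod_of_index {F : Type*} [Field F] [Fintype F] {q : ℕ}
    (hq : q = Fintype.card F) (α : Fˣ) (hα : ∀ β : Fˣ, β ∈ Subgroup.zpowers α)
    (ind : Fˣ → ℕ) (hind : ∀ β : Fˣ, α ^ ind β = β) :
    ∃ e : Fˣ ≃* Multiplicative (ZMod (q - 1)), ∀ β, (e β).toAdd = (ind β : ZMod (q - 1)) := by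
  classical
  have hcard : Nat.card Fˣ = q - 1 := by
    rw [Nat.card_eq_fintype_card, Fintype.card_units, hq]
  have hord : orderOf α = q - 1 := by rw [orderOf_eq_card_of_forall_mem_zpowers hα, hcard]
  have : NeZero (q - 1) := ⟨by rw [← hcard]; exact Nat.card_pos.ne'⟩
  let f : Fˣ →* Multiplicative (ZMod (q - 1)) := MonoidHom.mk'
    (fun β => Multiplicative.ofAdd (ind β : ZMod (q - 1))) (by
      intro a b
      rw [← ofAdd_add, ← Nat.cast_add, EmbeddingLike.apply_eq_iff_eq,
        ZMod.natCast_eq_natCast_iff, ← hord, ← pow_eq_pow_iff_modEq, pow_add, hind, hind, hind])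
  have hf : Function.Injective f := by
    intro a b hab
    have : (ind a : ZMod (q - 1)) = ind b := Multiplicative.ofAdd.injective hab
    rw [ZMod.natCast_eq_natCast_iff, ← hord, ← pow_eq_pow_iff_modEq, hind, hind] at this
    exact this
  have hbij : Function.Bijective f := by
    rw [Nat.bijective_iff_injective_and_card]
    refine ⟨hf, ?_⟩
    rw [hcard, Nat.card_congr Multiplicative.toAdd, Nat.card_zmod]
  exact ⟨MulEquiv.ofBijective f hbij, fun β => rfl⟩

/-- Counting points of a monomial map on a torus whose image satisfies a property `P`. -/
theorem IsSmithDatum.card_monomial_preimage {F : Type*} [Field F] [Fintype F] {q : ℕ}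
    (hq : q = Fintype.card F) (α : Fˣ) (hα : ∀ β : Fˣ, β ∈ Subgroup.zpowers α)
    (ind : Fˣ → ℕ) (hind : ∀ β : Fˣ, α ^ ind β = β)
    {ρ n : ℕ} {M : Matrix (Fin ρ) (Fin n) ℤ}
    {U : Matrix (Fin ρ) (Fin ρ) ℤ} {V : Matrix (Fin n) (Fin n) ℤ} {s : ℕ} {d : ℕ → ℕ}
    (hM : IsSmithDatum M U V s d) (P : (Fin ρ → Fˣ) → Prop) :
    Nat.card {x : Fin n → Fˣ // P fun i => ∏ j, x j ^ M i j} =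
      Nat.card {w : Fin ρ → Fˣ // P w ∧ IndexCond (q - 1) U s d fun i => (ind (w i) : ℤ)} *
        ((q - 1) ^ (n - s) * ∏ j ∈ range s, Nat.gcd (q - 1) (d j)) := by
  classical
  obtain ⟨e, he⟩ := exists_mulEquiv_zmod_of_index hq α hα ind hind
  have : NeZero (q - 1) :=
    ⟨by rw [hq, ← Fintype.card_units]; exact Fintype.card_ne_zero⟩
  have hfib : ∀ w : Fin ρ → Fˣ,
      Nat.card {x : Fin n → Fˣ // (fun i => ∏ j, x j ^ M i j) = w} =
        if IndexCond (q - 1) U s d fun i => (ind (w i) : ℤ) then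
          (q - 1) ^ (n - s) * ∏ j ∈ range s, Nat.gcd (q - 1) (d j) else 0 := by
    intro w
    rw [← hM.card_mulVec_eq (q - 1)]
    refine Nat.card_congr
      ((Equiv.piCongrRight fun _ => e.toEquiv.trans Multiplicative.toAdd).subtypeEquiv ?_)
    intro x
    rw [funext_iff, funext_iff]
    refine forall_congr' fun i => ?_
    rw [← e.injective.eq_iff, ← Multiplicative.toAdd.injective.eq_iff, he (w i), map_prod,
      toAdd_prod]
    simp [Matrix.mulVec, dotProduct, map_zpow]
  let φ : {x : Fin n → Fˣ // P fun i => ∏ j, x j ^ M i j} → {w : Fin ρ → Fˣ // P w} :=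
    fun x => ⟨fun i => ∏ j, x.1 j ^ M i j, x.2⟩
  rw [← Nat.card_congr (Equiv.sigmaFiberEquiv φ), Nat.card_sigma]
  have hφ : ∀ w : {w : Fin ρ → Fˣ // P w}, Nat.card {x // φ x = w} =
      if IndexCond (q - 1) U s d fun i => (ind (w.1 i) : ℤ) then
          (q - 1) ^ (n - s) * ∏ j ∈ range s, Nat.gcd (q - 1) (d j) else 0 := by
    intro w
    rw [← hfib]
    refine Nat.card_congr
      { toFun := fun x => ⟨x.1.1, congrArg Subtype.val x.2⟩
        invFun := fun x => ⟨⟨x.1, by rw [x.2]; exact w.2⟩, Subtype.ext x.2⟩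
        left_inv := fun x => rfl
        right_inv := fun x => rfl }
  simp only [hφ]
  rw [← Finset.sum_filter, Finset.sum_const, smul_eq_mul]
  congr 1
  rw [← Fintype.card_subtype, ← Nat.card_eq_fintype_card]
  exact Nat.card_congr (Equiv.subtypeSubtypeEquivSubtypeInter _
    fun w : Fin ρ → Fˣ => IndexCond (q - 1) U s d fun i => (ind (w i) : ℤ))

theorem rational_points_all_monomials_nonzero
    (F : Type) [Field F] [Fintype F] [DecidableEq F]
    (q : ℕ) (hq : q = Fintype.card F)
    (hqpow : ∃ p k : ℕ, Nat.Prime p ∧ Odd p ∧ 0 < k ∧ q = p ^ k)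
    (α : Fˣ) (hα : ∀ β : Fˣ, β ∈ Subgroup.zpowers α)
    (ind : Fˣ → ℕ)
    (hind : ∀ β : Fˣ, 1 ≤ ind β ∧ ind β ≤ q - 1 ∧ α ^ ind β = β)
    (r₁ r₂ r₃ r₄ n₁ n₂ n₃ n₄ : ℕ)
    (hr₁ : 0 < r₁) (hr₁₂ : r₁ < r₂) (hr₃ : 0 < r₃) (hr₃₄ : r₃ < r₄)
    (hn₁ : 0 < n₁) (hn₁₂ : n₁ < n₂) (hn₃ : 0 < n₃) (hn₃₄ : n₃ < n₄)
    (hn₁₃ : n₁ ≤ n₃)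
    (b₁ b₂ : F) (a₁ a₂ : ℕ → Fˣ)
    (E₁ E₂ : ℕ → ℕ → ℕ)
    (hE₁p : ∀ i, i < r₁ → ∀ j, j < n₁ → 0 < E₁ i j)
    (hE₁z : ∀ i, i < r₁ → ∀ j, n₁ ≤ j → E₁ i j = 0)
    (hE₁p' : ∀ i, r₁ ≤ i → i < r₂ → ∀ j, j < n₂ → 0 < E₁ i j)
    (hE₁z' : ∀ i, r₁ ≤ i → i < r₂ → ∀ j, n₂ ≤ j → E₁ i j = 0)
    (hE₂p : ∀ i, i < r₃ → ∀ j, j < n₃ → 0 < E₂ i j)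
    (hE₂z : ∀ i, i < r₃ → ∀ j, n₃ ≤ j → E₂ i j = 0)
    (hE₂p' : ∀ i, r₃ ≤ i → i < r₄ → ∀ j, j < n₄ → 0 < E₂ i j)
    (hE₂z' : ∀ i, r₃ ≤ i → i < r₄ → ∀ j, n₄ ≤ j → E₂ i j = 0)
    (h₂₄ : n₂ ≤ n₄)
    (U₄ : Matrix (Fin (r₂ + r₄)) (Fin (r₂ + r₄)) ℤ) (V₄ : Matrix (Fin (n₄)) (Fin (n₄)) ℤ)
    (s₄ : ℕ) (d₄ : ℕ → ℕ)
    (hSD₄ : IsSmithDatum (stackM E₁ E₂ r₂ r₄ n₄) U₄ V₄ s₄ d₄)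
    (H₄ : ℕ)
    (hH₄ : H₄ = Nat.card {w : Fin (r₂ + r₄) → Fˣ //
      (∑ i : Fin (r₂ + r₄), if (i : ℕ) < r₂ then (a₁ (i : ℕ) : F) * ((w i : F)) else 0) = b₁ ∧
      (∑ i : Fin (r₂ + r₄), if r₂ ≤ (i : ℕ) then (a₂ ((i : ℕ) - r₂) : F) * ((w i : F)) else 0) = b₂ ∧
      IndexCond (q - 1) U₄ s₄ d₄ fun i => (ind (w i) : ℤ)})
    :
    Nat.card {x : Fin n₄ → F //
      (∑ i ∈ Finset.range r₂, (a₁ i : F) * ∏ j : Fin n₄, x j ^ E₁ i (j : ℕ)) = b₁ ∧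
      (∑ i ∈ Finset.range r₄, (a₂ i : F) * ∏ j : Fin n₄, x j ^ E₂ i (j : ℕ)) = b₂ ∧
      (∀ i, i < r₂ → (∏ j : Fin n₄, x j ^ E₁ i (j : ℕ)) ≠ 0) ∧
      (∀ i, i < r₄ → (∏ j : Fin n₄, x j ^ E₂ i (j : ℕ)) ≠ 0)} =
      H₄ * (q - 1) ^ (n₄ - s₄) * ∏ j ∈ Finset.range s₄, Nat.gcd (q - 1) (d₄ j) := by
  set M := stackM E₁ E₂ r₂ r₄ n₄ with hMdef
  have hM₁ : ∀ (x : Fin n₄ → Fˣ) (i : Fin r₂),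
      ((∏ j, x j ^ M (Fin.castAdd r₄ i) j : Fˣ) : F) = ∏ j, (x j : F) ^ E₁ i j := by
    intro x i
    simp [hMdef, stackM]
  have hM₂ : ∀ (x : Fin n₄ → Fˣ) (i : Fin r₄),
      ((∏ j, x j ^ M (Fin.natAdd r₂ i) j : Fˣ) : F) = ∏ j, (x j : F) ^ E₂ i j := by
    intro x i
    simp [hMdef, stackM]
  have hne : ∀ x : Fin n₄ → F, (∀ i, i < r₄ → (∏ j : Fin n₄, x j ^ E₂ i (j : ℕ)) ≠ 0) →
      ∀ j, x j ≠ 0 := by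
    intro x hx j hj
    refine hx r₃ hr₃₄ (Finset.prod_eq_zero (Finset.mem_univ j) ?_)
    rw [hj, zero_pow (hE₂p' r₃ le_rfl hr₃₄ j j.2).ne']
  let P : (Fin (r₂ + r₄) → Fˣ) → Prop := fun w =>
    (∑ i : Fin (r₂ + r₄), if (i : ℕ) < r₂ then (a₁ (i : ℕ) : F) * ((w i : F)) else 0) = b₁ ∧
    (∑ i : Fin (r₂ + r₄),
      if r₂ ≤ (i : ℕ) then (a₂ ((i : ℕ) - r₂) : F) * ((w i : F)) else 0) = b₂
  have hP : ∀ x : Fin n₄ → Fˣ, (P fun i => ∏ j, x j ^ M i j) ↔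
      (∑ i ∈ Finset.range r₂, (a₁ i : F) * ∏ j : Fin n₄, (x j : F) ^ E₁ i (j : ℕ)) = b₁ ∧
      (∑ i ∈ Finset.range r₄, (a₂ i : F) * ∏ j : Fin n₄, (x j : F) ^ E₂ i (j : ℕ)) = b₂ := by
    intro x
    simp only [P, Fin.sum_univ_add, hM₁, hM₂, Finset.sum_range]
    simp [fun i : Fin r₂ => not_le.2 i.2]
  have key := hSD₄.card_monomial_preimage hq α hα ind (fun β => (hind β).2.2) P
  have hH : H₄ = Nat.card {w : Fin (r₂ + r₄) → Fˣ //
      P w ∧ IndexCond (q - 1) U₄ s₄ d₄ fun i => (ind (w i) : ℤ)} := by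
    rw [hH₄]
    exact Nat.card_congr (Equiv.subtypeEquivRight fun w => and_assoc.symm)
  rw [hH, mul_assoc, ← key]
  symm
  refine Nat.card_congr
    { toFun := fun x => ⟨fun j => x.1 j, ((hP x.1).1 x.2).1, ((hP x.1).1 x.2).2,
        fun i _ => Finset.prod_ne_zero_iff.2 fun j _ => pow_ne_zero _ (x.1 j).ne_zero,
        fun i _ => Finset.prod_ne_zero_iff.2 fun j _ => pow_ne_zero _ (x.1 j).ne_zero⟩
      invFun := fun x => ⟨fun j => Units.mk0 (x.1 j) (hne x.1 x.2.2.2.2 j),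
        (hP _).2 ⟨x.2.1, x.2.2.1⟩⟩
      left_inv := fun x => by ext; rfl
      right_inv := fun x => rfl }
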